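/- arXiv:2407.19999 — 2 statements merged into one kernel-verified Lean document; each statement's English description precedes it below -/
import Mathlib

section
/- Let R be a commutative Noetherian local ring and M a finitely generated R-module with Ext^i_R(M, R) = 0 for all i > 0. Then Ext^i_R(M, M) ≅ Ext^i_R(ΩM, ΩM) for all i > 0. Consequently, if Ext^i_R(M, M ⊕ R) = 0 for all i > 0, then Ext^i_R(ΩM, ΩM ⊕ R) = 0 for all i > 0. -/
open CategoryTheory Opposite IsLocalRing

universe u

variable (R : Type u) [CommRing R]

/-- The Ext module `Ext^i_R(M, N)` as an object of `ModuleCat R`. -/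
noncomputable def ExtMod (i : ℕ) (M N : Type u) [AddCommGroup M] [Module R M]
    [AddCommGroup N] [Module R N] : ModuleCat.{u} R :=
  ((Ext R (ModuleCat.{u} R) i).obj (op (ModuleCat.of R M))).obj (ModuleCat.of R N)

/-- The annihilator of `Ext^i_R(M, N)`. -/
noncomputable def extAnn (i : ℕ) (M N : Type u) [AddCommGroup M] [Module R M]
    [AddCommGroup N] [Module R N] : Ideal R :=
  Module.annihilator R (ExtMod R i M N)

/-- `S` is a (first) syzygy of `M`: the kernel of a surjection from a
finitely generated free module onto `M`. -/
def IsSyzygy (M S : Type u) [AddCommGroup M] [Module R M] [AddCommGroup S] [Module R S] : Prop :=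
  ∃ (F : Type u) (_ : AddCommGroup F) (_ : Module R F) (ι : S →ₗ[R] F) (π : F →ₗ[R] M),
    Module.Free R F ∧ Module.Finite R F ∧ Function.Injective ι ∧ Function.Surjective π ∧
      LinearMap.range ι = LinearMap.ker π

/-- The submodule of `Hom_R(M,N)` of maps factoring through a free module. -/
def stablyTrivial (M N : Type u) [AddCommGroup M] [Module R M] [AddCommGroup N] [Module R N] :
    Submodule R (M →ₗ[R] N) :=
  Submodule.span R {f : M →ₗ[R] N | ∃ (F : Type u) (_ : AddCommGroup F) (_ : Module R F),
    Module.Free R F ∧ ∃ (g : M →ₗ[R] F) (h : F →ₗ[R] N), h ∘ₗ g = f}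

/-- The stable annihilator of `M`: the annihilator of `End_R(M)/P(M,M)`. -/
noncomputable def stableAnn (M : Type u) [AddCommGroup M] [Module R M] : Ideal R :=
  Module.annihilator R ((M →ₗ[R] M) ⧸ stablyTrivial R M M)

/-- The Auslander–Reiten annihilator `⋂_{i>0} ann Ext^i(M, M ⊕ R)`. -/
noncomputable def ARann (M : Type u) [AddCommGroup M] [Module R M] : Ideal R :=
  ⨅ i : ℕ, extAnn R (i + 1) M (M × R)

/-- Depth of a module over a local ring: supremum of lengths of regular sequences
contained in the maximal ideal. -/
noncomputable def moduleDepth [IsLocalRing R] (M : Type u) [AddCommGroup M] [Module R M] : ℕ∞ :=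
  sSup {n : ℕ∞ | ∃ rs : List R, (∀ r ∈ rs, r ∈ maximalIdeal R) ∧
    RingTheory.Sequence.IsRegular M rs ∧ (rs.length : ℕ∞) = n}

/-- `ω` is a canonical module of the `d`-dimensional Cohen-Macaulay local ring `R`:
it is finitely generated and `Ext^i(k, ω)` vanishes for `i ≠ d` and is `k` for `i = d`. -/
def IsCanonicalModule [IsLocalRing R] (d : ℕ) (ω : Type u) [AddCommGroup ω] [Module R ω] :
    Prop :=
  Module.Finite R ω ∧
    (∀ i : ℕ, i ≠ d → Subsingleton (ExtMod R i (ResidueField R) ω)) ∧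
    Nonempty ((ExtMod R d (ResidueField R) ω) ≃ₗ[R] ResidueField R)

/-- A Gorenstein local ring: Noetherian local, and the ring itself is a canonical module. -/
def IsGorensteinLocal (A : Type u) [CommRing A] [IsLocalRing A] : Prop :=
  IsNoetherianRing A ∧ ∃ d : ℕ, ringKrullDim A = d ∧ IsCanonicalModule A d A

/-- A regular local ring: Noetherian local whose maximal ideal is generated by
`dim` elements. -/
def IsRegularLocal (A : Type u) [CommRing A] [IsLocalRing A] : Prop :=
  IsNoetherianRing A ∧ ∃ (d : ℕ) (s : Finset A), ringKrullDim A = (d : ℕ) ∧ s.card = d ∧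
    Ideal.span (s : Set A) = maximalIdeal A

/-- `S` is an `n`-th syzygy of `M`. -/
def IsNthSyzygy : (n : ℕ) → ∀ (M S : Type u) [AddCommGroup M] [Module R M]
    [AddCommGroup S] [Module R S], Prop
  | 0 => fun M S _ _ _ _ => Nonempty (M ≃ₗ[R] S)
  | n + 1 => fun M S _ _ _ _ => ∃ (T : Type u) (_ : AddCommGroup T) (_ : Module R T),
      IsSyzygy R M T ∧ IsNthSyzygy n T S

/-- Maximal Cohen-Macaulay module: finitely generated with depth equal to the
Krull dimension of the ring. -/
def IsMCM [IsLocalRing R] (M : Type u) [AddCommGroup M] [Module R M] : Prop :=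
  Module.Finite R M ∧ (moduleDepth R M : WithBot ℕ∞) = ringKrullDim R

/-- The trace ideal of a module. -/
def traceIdeal (M : Type u) [AddCommGroup M] [Module R M] : Ideal R :=
  ⨆ f : M →ₗ[R] R, LinearMap.range f

open CategoryTheory.Abelian in
theorem smul_extMk_aux (R : Type u) [CommRing R] {X Y : ModuleCat.{u} R}
    (P : ProjectiveResolution X) (n : ℕ) (r : R) (f : P.complex.X (n+1) ⟶ Y)
    (hf : P.complex.d (n+2) (n+1) ≫ f = 0) (hf' : P.complex.d (n+2) (n+1) ≫ (r • f) = 0) :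
    P.extMk (r • f) (n+2) rfl hf' = r • P.extMk f (n+2) rfl hf := by
  rw [Ext.smul_eq_comp_mk₀, P.extMk_comp_mk₀]
  congr 1

open CategoryTheory.Abelian in
/-- Cocycles modulo coboundaries surject onto `Ext`. -/
noncomputable def extMkLin (R : Type u) [CommRing R] {X Y : ModuleCat.{u} R}
    (P : ProjectiveResolution X) (n : ℕ) :
    LinearMap.ker (((P.complex.linearYonedaObj R Y).sc' n (n+1) (n+2)).g).hom →ₗ[R]
      Abelian.Ext.{u} X Y (n+1) where
  toFun f := P.extMk (Y := Y) (n := n+1) f.1 (n+2) rfl f.2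
  map_add' f g := (P.add_extMk _ _ _ _ _ _).symm
  map_smul' r f := smul_extMk_aux R P n r f.1 f.2 _

open CategoryTheory.Abelian in
theorem extMod_equiv (R : Type u) [CommRing R] (i : ℕ) (hi : 0 < i) (M N : Type u)
    [AddCommGroup M] [Module R M] [AddCommGroup N] [Module R N] :
    Nonempty (ExtMod R i M N ≃ₗ[R] Abelian.Ext.{u} (ModuleCat.of R M) (ModuleCat.of R N) i) := by
  obtain ⟨n, rfl⟩ : ∃ n, i = n + 1 := ⟨i - 1, by omega⟩
  let P := ProjectiveResolution.of (ModuleCat.of R M)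
  let K := P.complex.linearYonedaObj R (ModuleCat.of R N)
  let e1 : ExtMod R (n+1) M N ≅ K.homology (n+1) := P.isoExt (n+1) (ModuleCat.of R N)
  let e2 : K.homology (n+1) ≅ (K.sc' n (n+1) (n+2)).homology :=
    ShortComplex.homologyMapIso (K.isoSc' n (n+1) (n+2) (by simp) (by simp))
  let e3 := (K.sc' n (n+1) (n+2)).moduleCatHomologyIso
  let φ := extMkLin R (Y := ModuleCat.of R N) P n
  have hφ : Function.Surjective φ := by
    intro a
    obtain ⟨f, hf, rfl⟩ := P.extMk_surjective a (n+2) rfl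
    exact ⟨⟨f, hf⟩, rfl⟩
  have hk : LinearMap.ker φ = LinearMap.range (K.sc' n (n+1) (n+2)).moduleCatToCycles := by
    ext f
    rw [LinearMap.mem_ker, LinearMap.mem_range]
    refine (P.extMk_eq_zero_iff (n := n+1) f.1 (n+2) rfl f.2 n rfl).trans ?_
    constructor
    · rintro ⟨g, hg⟩
      exact ⟨g, Subtype.ext hg⟩
    · rintro ⟨g, hg⟩
      exact ⟨g, congrArg Subtype.val hg⟩
  exact ⟨(e1 ≪≫ e2 ≪≫ e3).toLinearEquiv.trans
    ((Submodule.quotEquivOfEq _ _ hk.symm).trans (φ.quotKerEquivOfSurjective hφ))⟩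

open CategoryTheory.Abelian in
theorem ext_free_zero (R : Type u) [CommRing R] (X : ModuleCat.{u} R) (F : Type u)
    [AddCommGroup F] [Module R F] [Module.Free R F] [Module.Finite R F] (i : ℕ)
    (h : Subsingleton (Abelian.Ext.{u} X (ModuleCat.of R R) i))
    (x : Abelian.Ext.{u} X (ModuleCat.of R F) i) : x = 0 := by
  let b := Module.Free.chooseBasis R F
  have hid : 𝟙 (ModuleCat.of R F) = ∑ j, (ModuleCat.ofHom (b.coord j) ≫
      ModuleCat.ofHom (LinearMap.toSpanSingleton R F (b j))) := by
    ext v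
    simp only [ModuleCat.hom_sum, LinearMap.sum_apply]
    simpa using (b.sum_repr v).symm
  rw [← Ext.comp_mk₀_id x, hid, Ext.mk₀_sum, Ext.comp_sum]
  refine Finset.sum_eq_zero fun j _ => ?_
  rw [← Ext.mk₀_comp_mk₀, ← Ext.comp_assoc_of_third_deg_zero,
    Subsingleton.elim (x.comp (Ext.mk₀ (ModuleCat.ofHom (b.coord j))) (add_zero i)) 0,
    Ext.zero_comp]

open CategoryTheory.Abelian in
theorem ext_prod_zero (R : Type u) [CommRing R] (X : ModuleCat.{u} R) (A B : Type u)
    [AddCommGroup A] [Module R A] [AddCommGroup B] [Module R B] (i : ℕ) :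
    Subsingleton (Abelian.Ext.{u} X (ModuleCat.of R (A × B)) i) ↔
    Subsingleton (Abelian.Ext.{u} X (ModuleCat.of R A) i) ∧
    Subsingleton (Abelian.Ext.{u} X (ModuleCat.of R B) i) := by
  have hid : 𝟙 (ModuleCat.of R (A × B)) =
      ModuleCat.ofHom (LinearMap.fst R A B) ≫ ModuleCat.ofHom (LinearMap.inl R A B) +
      ModuleCat.ofHom (LinearMap.snd R A B) ≫ ModuleCat.ofHom (LinearMap.inr R A B) := by
    ext v <;> simp
  have key : ∀ {Y Z : ModuleCat.{u} R} (f : Y ⟶ Z) (g : Z ⟶ Y), f ≫ g = 𝟙 Y →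
      Subsingleton (Abelian.Ext.{u} X Z i) → Subsingleton (Abelian.Ext.{u} X Y i) := by
    intro Y Z f g hfg hZ
    refine subsingleton_of_forall_eq 0 fun x => ?_
    rw [← Ext.comp_mk₀_id x, ← hfg, ← Ext.mk₀_comp_mk₀, ← Ext.comp_assoc_of_third_deg_zero,
      Subsingleton.elim (x.comp (Ext.mk₀ f) (add_zero i)) 0, Ext.zero_comp]
  constructor
  · intro h
    exact ⟨key (ModuleCat.ofHom (LinearMap.inl R A B)) (ModuleCat.ofHom (LinearMap.fst R A B))
        (by ext; simp) h,
      key (ModuleCat.ofHom (LinearMap.inr R A B)) (ModuleCat.ofHom (LinearMap.snd R A B))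
        (by ext; simp) h⟩
  · rintro ⟨h1, h2⟩
    refine subsingleton_of_forall_eq 0 fun x => ?_
    rw [← Ext.comp_mk₀_id x, hid, Ext.mk₀_add, Ext.comp_add,
      ← Ext.mk₀_comp_mk₀, ← Ext.comp_assoc_of_third_deg_zero,
      Subsingleton.elim (x.comp (Ext.mk₀ (ModuleCat.ofHom (LinearMap.fst R A B))) (add_zero i)) 0,
      ← Ext.mk₀_comp_mk₀, ← Ext.comp_assoc_of_third_deg_zero,
      Subsingleton.elim (x.comp (Ext.mk₀ (ModuleCat.ofHom (LinearMap.snd R A B))) (add_zero i)) 0,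
      Ext.zero_comp, Ext.zero_comp, add_zero]

open CategoryTheory.Abelian in
theorem ext_shift_first (R : Type u) [CommRing R] {T : ShortComplex (ModuleCat.{u} R)}
    (hT : T.ShortExact) [Projective T.X₂] (Y : ModuleCat.{u} R) (i : ℕ) (hi : 0 < i) :
    Nonempty (Abelian.Ext.{u} T.X₁ Y i ≃ₗ[R] Abelian.Ext.{u} T.X₃ Y (i+1)) := by
  obtain ⟨n, rfl⟩ : ∃ n, i = n + 1 := ⟨i - 1, by omega⟩
  refine ⟨LinearEquiv.ofBijective (hT.extClass.precompOfLinear R Y (add_comm 1 (n+1))) ⟨?_, ?_⟩⟩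
  · rw [injective_iff_map_eq_zero]
    intro x hx
    obtain ⟨y, rfl⟩ := Ext.contravariant_sequence_exact₁ hT Y x (add_comm 1 (n+1)) hx
    rw [Ext.eq_zero_of_projective y, Ext.comp_zero]
  · exact precomp_extClass_surjective_of_projective_X₂ Y hT (n+1)

open CategoryTheory.Abelian in
theorem ext_shift_second (R : Type u) [CommRing R] {T : ShortComplex (ModuleCat.{u} R)}
    (hT : T.ShortExact) (X : ModuleCat.{u} R) (i : ℕ)
    (h1 : ∀ x : Abelian.Ext.{u} X T.X₂ i, x = 0)
    (h2 : ∀ x : Abelian.Ext.{u} X T.X₂ (i + 1), x = 0) :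
    Nonempty (Abelian.Ext.{u} X T.X₃ i ≃ₗ[R] Abelian.Ext.{u} X T.X₁ (i+1)) := by
  refine ⟨LinearEquiv.ofBijective (hT.extClass.postcompOfLinear R X rfl) ⟨?_, ?_⟩⟩
  · rw [injective_iff_map_eq_zero]
    intro x hx
    obtain ⟨y, rfl⟩ := Ext.covariant_sequence_exact₃ X hT x rfl hx
    rw [h1 y, Ext.zero_comp]
  · intro x
    exact Ext.covariant_sequence_exact₁ X hT x (h2 _) rfl

/-- If `Ext^i(M, R) = 0` for all `i > 0`, then `Ext^i(M, M) ≅ Ext^i(ΩM, ΩM)` for all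
`i > 0`; consequently if `Ext^i(M, M ⊕ R) = 0` for all `i > 0`, then
`Ext^i(ΩM, ΩM ⊕ R) = 0` for all `i > 0`. -/
theorem stmt6 (R : Type u) [CommRing R] [IsNoetherianRing R] [IsLocalRing R]
    (M S : Type u) [AddCommGroup M] [Module R M] [Module.Finite R M]
    [AddCommGroup S] [Module R S]
    (hS : IsSyzygy R M S)
    (hvanish : ∀ i : ℕ, 0 < i → Subsingleton (ExtMod R i M R)) :
    (∀ i : ℕ, 0 < i → Nonempty (ExtMod R i M M ≅ ExtMod R i S S)) ∧
      ((∀ i : ℕ, 0 < i → Subsingleton (ExtMod R i M (M × R))) →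
        ∀ i : ℕ, 0 < i → Subsingleton (ExtMod R i S (S × R))) := by
  obtain ⟨F, _, _, ι, π, _, _, hι, hπ, hex⟩ := hS
  let T : ShortComplex (ModuleCat.{u} R) :=
    ShortComplex.mk (ModuleCat.ofHom ι) (ModuleCat.ofHom π) (by
      ext x
      have : ι x ∈ LinearMap.ker π := hex ▸ LinearMap.mem_range_self ι x
      simpa using this)
  have hT : T.ShortExact :=
    { exact := (ShortComplex.ShortExact.moduleCat_exact_iff_function_exact _).mpr
        (LinearMap.exact_iff.mpr hex.symm)
      mono_f := (ModuleCat.mono_iff_injective _).mpr hι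
      epi_g := (ModuleCat.epi_iff_surjective _).mpr hπ }
  have : Projective T.X₂ := ModuleCat.projective_of_free (M := ModuleCat.of R F)
    (Module.Free.chooseBasis R F)
  have hR : ∀ i : ℕ, 0 < i →
      Subsingleton (Abelian.Ext.{u} (ModuleCat.of R M) (ModuleCat.of R R) i) := fun i hi => by
    obtain ⟨e⟩ := extMod_equiv R i hi M R
    have := hvanish i hi
    exact e.symm.toEquiv.subsingleton
  have hMS : ∀ i : ℕ, 0 < i → Nonempty (ExtMod R i M M ≃ₗ[R] ExtMod R i S S) := by
    intro i hi
    obtain ⟨e1⟩ := extMod_equiv R i hi M M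
    obtain ⟨e2⟩ := extMod_equiv R i hi S S
    obtain ⟨e3⟩ := ext_shift_second R hT (ModuleCat.of R M) i
      (ext_free_zero R _ F i (hR i hi)) (ext_free_zero R _ F (i+1) (hR (i+1) (by omega)))
    obtain ⟨e4⟩ := ext_shift_first R hT (ModuleCat.of R S) i hi
    exact ⟨e1.trans (e3.trans (e4.symm.trans e2.symm))⟩
  refine ⟨fun i hi => ⟨(hMS i hi).some.toModuleIso⟩, fun h i hi => ?_⟩
  obtain ⟨e⟩ := extMod_equiv R i hi S (S × R)
  refine @Equiv.subsingleton _ _ e.toEquiv ((ext_prod_zero R _ S R i).mpr ⟨?_, ?_⟩)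
  · obtain ⟨e1⟩ := extMod_equiv R i hi M (M × R)
    have h0 := h i hi
    have h1 := ((ext_prod_zero R _ M R i).mp e1.symm.toEquiv.subsingleton).1
    obtain ⟨e2⟩ := extMod_equiv R i hi M M
    obtain ⟨e3⟩ := extMod_equiv R i hi S S
    obtain ⟨e4⟩ := hMS i hi
    exact (e3.symm.trans (e4.symm.trans e2)).toEquiv.subsingleton
  · obtain ⟨e4⟩ := ext_shift_first R hT (ModuleCat.of R R) i hi
    have := hR (i+1) (by omega)
    exact e4.toEquiv.subsingleton
end

section
/- Let R be a commutative Noetherian local ring and M a finitely generated R-module. The intersection of the annihilators ann_R Ext^1_R(M, N), taken over all finitely generated R-modules N, equals ann_R Ext^1_R(M, ΩM), where ΩM is a syzygy of M. -/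
open CategoryTheory Opposite IsLocalRing

universe u

variable (R : Type u) [CommRing R]

/-- An element annihilates the homology of a short complex of modules iff it sends
cycles to boundaries. -/
theorem mem_ann_homology_iff {R : Type u} [CommRing R] (T : ShortComplex (ModuleCat.{u} R))
    (r : R) : r ∈ Module.annihilator R T.homology ↔
      ∀ x : T.X₂, T.g x = 0 → ∃ y : T.X₁, T.f y = r • x := by
  rw [(T.moduleCatHomologyIso.toLinearEquiv).annihilator_eq, Module.mem_annihilator]
  constructor
  · intro h x hx
    have h1 := h (Submodule.Quotient.mk (⟨x, hx⟩ : LinearMap.ker T.g.hom))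
    erw [← Submodule.Quotient.mk_smul, Submodule.Quotient.mk_eq_zero] at h1
    obtain ⟨y, hy⟩ := h1
    exact ⟨y, congrArg Subtype.val hy⟩
  · intro h q
    obtain ⟨⟨x, hx⟩, rfl⟩ := Submodule.Quotient.mk_surjective _ q
    obtain ⟨y, hy⟩ := h x hx
    erw [← Submodule.Quotient.mk_smul, Submodule.Quotient.mk_eq_zero]
    exact ⟨y, Subtype.ext hy⟩

/-- Criterion for annihilating `Ext¹` through a projective resolution. -/
theorem mem_extAnn_one_iff {R : Type u} [CommRing R] (M N : Type u) [AddCommGroup M] [Module R M]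
    [AddCommGroup N] [Module R N] (P : ProjectiveResolution (ModuleCat.of R M)) (r : R) :
    r ∈ extAnn R 1 M N ↔ ∀ f : P.complex.X 1 →ₗ[R] N, f ∘ₗ (P.complex.d 2 1).hom = 0 →
      ∃ g : P.complex.X 0 →ₗ[R] N, g ∘ₗ (P.complex.d 1 0).hom = r • f := by
  have e := (P.isoExt (R := R) 1 (ModuleCat.of R N)) ≪≫
    (ShortComplex.homologyMapIso
      ((P.complex.linearYonedaObj R (ModuleCat.of R N)).isoSc' 0 1 2 (by simp) (by simp)))
  have h := e.toLinearEquiv.annihilator_eq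
  unfold extAnn ExtMod
  rw [h, mem_ann_homology_iff]
  constructor
  · intro h f hf
    obtain ⟨y, hy⟩ := h (ModuleCat.ofHom f) (ModuleCat.hom_ext hf)
    exact ⟨ModuleCat.Hom.hom y, congrArg ModuleCat.Hom.hom hy⟩
  · intro h x hx
    obtain ⟨g, hg⟩ := h (ModuleCat.Hom.hom x) (congrArg ModuleCat.Hom.hom hx)
    exact ⟨ModuleCat.ofHom g, ModuleCat.hom_ext hg⟩

/-- Lift a map into the kernel of a composite along an injection. -/
theorem exists_lift_of_range_eq_ker {R : Type u} [CommRing R] {S F M Q : Type u}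
    [AddCommGroup S] [Module R S] [AddCommGroup F] [Module R F] [AddCommGroup M] [Module R M]
    [AddCommGroup Q] [Module R Q] (ι : S →ₗ[R] F) (π : F →ₗ[R] M)
    (hι : Function.Injective ι) (hex : LinearMap.range ι = LinearMap.ker π)
    (k : Q →ₗ[R] F) (hk : ∀ q, π (k q) = 0) : ∃ l : Q →ₗ[R] S, ∀ q, ι (l q) = k q := by
  have hk' : ∀ q, k q ∈ LinearMap.range ι := fun q => by
    rw [hex]; exact hk q
  refine ⟨(LinearEquiv.ofInjective ι hι).symm.toLinearMap ∘ₗ k.codRestrict _ hk', fun q => ?_⟩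
  have := (LinearEquiv.ofInjective ι hι).apply_symm_apply (k.codRestrict _ hk' q)
  exact congrArg Subtype.val this

section
variable {R : Type u} [CommRing R] {S F M N P₀ P₁ P₂ : Type u}
    [AddCommGroup S] [Module R S] [AddCommGroup F] [Module R F] [AddCommGroup M] [Module R M]
    [AddCommGroup N] [Module R N]
    [AddCommGroup P₀] [Module R P₀] [AddCommGroup P₁] [Module R P₁] [AddCommGroup P₂] [Module R P₂]

theorem syz_forward [Module.Projective R F] [Module.Projective R P₀]
    (ι : S →ₗ[R] F) (π : F →ₗ[R] M) (hι : Function.Injective ι) (hπ : Function.Surjective π)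
    (hex : LinearMap.range ι = LinearMap.ker π)
    (d₂ : P₂ →ₗ[R] P₁) (d₁ : P₁ →ₗ[R] P₀) (ε : P₀ →ₗ[R] M) (hε : Function.Surjective ε)
    (h21 : ∀ x, d₁ (d₂ x) = 0)
    (h10 : LinearMap.range d₁ = LinearMap.ker ε) (r : R)
    (H : ∀ f : P₁ →ₗ[R] S, f ∘ₗ d₂ = 0 → ∃ g : P₀ →ₗ[R] S, g ∘ₗ d₁ = r • f) :
    ∃ g : F →ₗ[R] S, ∀ x, g (ι x) = r • x := by
  have hπι : ∀ x, π (ι x) = 0 := fun x => by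
    have : ι x ∈ LinearMap.ker π := hex ▸ ⟨x, rfl⟩
    exact this
  have hεd : ∀ x, ε (d₁ x) = 0 := fun x => by
    have : d₁ x ∈ LinearMap.ker ε := h10 ▸ ⟨x, rfl⟩
    exact this
  obtain ⟨a, ha⟩ := Module.projective_lifting_property π ε hπ
  obtain ⟨s, hs⟩ := Module.projective_lifting_property ε π hε
  replace ha : ∀ x, π (a x) = ε x := fun x => LinearMap.congr_fun ha x
  replace hs : ∀ x, ε (s x) = π x := fun x => LinearMap.congr_fun hs x
  obtain ⟨b, hb⟩ := exists_lift_of_range_eq_ker ι π hι hex (a ∘ₗ d₁) (fun q => by simp [ha, hεd])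
  obtain ⟨k, hk⟩ := exists_lift_of_range_eq_ker ι π hι hex (a ∘ₗ s - LinearMap.id)
    (fun q => by simp [ha, hs])
  obtain ⟨c, hc⟩ := H b (by ext x; apply hι; simp [hb, h21])
  replace hc : ∀ x, c (d₁ x) = r • b x := fun x => LinearMap.congr_fun hc x
  refine ⟨c ∘ₗ s - r • k, fun x => ?_⟩
  have : s (ι x) ∈ LinearMap.range d₁ := by
    rw [h10]; simp [hs, hπι]
  obtain ⟨y, hy⟩ := this
  have hby : b y = x + k (ι x) := by
    apply hι
    simp [hb, hk, hy]
  simp [← hy, hc, hby]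

theorem syz_backward [Module.Projective R F] [Module.Projective R P₀]
    (ι : S →ₗ[R] F) (π : F →ₗ[R] M) (hπ : Function.Surjective π)
    (hex : LinearMap.range ι = LinearMap.ker π)
    (d₂ : P₂ →ₗ[R] P₁) (d₁ : P₁ →ₗ[R] P₀) (ε : P₀ →ₗ[R] M) (hε : Function.Surjective ε)
    (h21 : LinearMap.range d₂ = LinearMap.ker d₁)
    (h10 : LinearMap.range d₁ = LinearMap.ker ε) (r : R)
    (g : F →ₗ[R] S) (hg : ∀ x, g (ι x) = r • x)
    (f : P₁ →ₗ[R] N) (hf : f ∘ₗ d₂ = 0) : ∃ c : P₀ →ₗ[R] N, c ∘ₗ d₁ = r • f := by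
  have hπι : ∀ x, π (ι x) = 0 := fun x => by
    have : ι x ∈ LinearMap.ker π := hex ▸ ⟨x, rfl⟩
    exact this
  have hεd : ∀ x, ε (d₁ x) = 0 := fun x => by
    have : d₁ x ∈ LinearMap.ker ε := h10 ▸ ⟨x, rfl⟩
    exact this
  obtain ⟨a, ha⟩ := Module.projective_lifting_property π ε hπ
  obtain ⟨s, hs⟩ := Module.projective_lifting_property ε π hε
  replace ha : ∀ x, π (a x) = ε x := fun x => LinearMap.congr_fun ha x
  replace hs : ∀ x, ε (s x) = π x := fun x => LinearMap.congr_fun hs x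
  have hker : LinearMap.ker d₁ ≤ LinearMap.ker f := by
    rw [← h21]
    rintro _ ⟨z, rfl⟩
    exact LinearMap.congr_fun hf z
  -- descend `f` to the range of `d₁`
  obtain ⟨fb, hfb⟩ : ∃ fb : LinearMap.range d₁ →ₗ[R] N, ∀ y, fb (d₁.rangeRestrict y) = f y := by
    refine ⟨(LinearMap.ker d₁).liftQ f hker ∘ₗ d₁.quotKerEquivRange.symm.toLinearMap, fun y => ?_⟩
    have : d₁.quotKerEquivRange.symm (d₁.rangeRestrict y) = Submodule.Quotient.mk y := by
      rw [LinearEquiv.symm_apply_eq]; rfl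
    simp only [LinearMap.comp_apply, LinearEquiv.coe_coe, this]
    rfl
  have hsι : ∀ x, (s ∘ₗ ι) x ∈ LinearMap.range d₁ := fun x => by
    rw [h10]; simp [hs, hπι]
  have hsa : ∀ x : P₀, (s ∘ₗ a - LinearMap.id : P₀ →ₗ[R] P₀) x ∈ LinearMap.range d₁ := fun x => by
    rw [h10]; simp [hs, ha]
  obtain ⟨t, ht⟩ := Module.projective_lifting_property d₁.rangeRestrict
    ((s ∘ₗ a - LinearMap.id : P₀ →ₗ[R] P₀).codRestrict _ hsa) d₁.surjective_rangeRestrict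
  replace ht : ∀ x, d₁ (t x) = s (a x) - x := fun x =>
    congrArg Subtype.val (LinearMap.congr_fun ht x)
  refine ⟨fb ∘ₗ (s ∘ₗ ι).codRestrict _ hsι ∘ₗ g ∘ₗ a - r • (f ∘ₗ t), ?_⟩
  ext y
  have : a (d₁ y) ∈ LinearMap.range ι := by
    rw [hex]; simp [ha, hεd]
  obtain ⟨x, hx⟩ := this
  have key : (s ∘ₗ ι).codRestrict _ hsι x = d₁.rangeRestrict (y + t (d₁ y)) := by
    apply Subtype.ext
    simp [ht, hx]
  have key2 := congrArg fb key
  rw [hfb] at key2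
  simp only [LinearMap.sub_apply, LinearMap.comp_apply, LinearMap.smul_apply, ← hx, hg, map_smul]
  rw [key2, map_add, smul_add, add_sub_cancel_right]

end

/-- The intersection of `ann Ext¹(M, N)` over all finitely generated `N` equals
`ann Ext¹(M, ΩM)`. -/
theorem stmt8 (R : Type u) [CommRing R] [IsNoetherianRing R] [IsLocalRing R]
    (M S : Type u) [AddCommGroup M] [Module R M] [Module.Finite R M]
    [AddCommGroup S] [Module R S] (hS : IsSyzygy R M S) :
    (⨅ (N : ModuleCat.{u} R) (_ : Module.Finite R N), extAnn R 1 M N) =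
      extAnn R 1 M S := by
  obtain ⟨F, _, _, ι, π, hfree, hfin, hι, hπ, hex⟩ := hS
  have hSfin : Module.Finite R S := Module.Finite.of_injective ι hι
  apply le_antisymm
  · exact iInf₂_le (ModuleCat.of R S) hSfin
  · refine le_iInf₂ fun N _ r hr => ?_
    let P := ProjectiveResolution.of (ModuleCat.of R M)
    have hproj : Module.Projective R (P.complex.X 0) :=
      (IsProjective.iff_projective (P.complex.X 0)).mpr (P.projective 0)
    have hε : Function.Surjective (P.π.f 0).hom :=
      (ModuleCat.epi_iff_surjective (P.π.f 0)).mp inferInstance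
    have h10 := P.exact₀.moduleCat_range_eq_ker
    have h21 := (P.exact_succ 0).moduleCat_range_eq_ker
    rw [mem_extAnn_one_iff M _ P] at hr ⊢
    obtain ⟨g, hg⟩ := syz_forward ι π hι hπ hex (P.complex.d 2 1).hom (P.complex.d 1 0).hom
      (P.π.f 0).hom hε
      (fun x => LinearMap.congr_fun (congrArg ModuleCat.Hom.hom (P.complex.d_comp_d 2 1 0)) x)
      h10 r hr
    intro f hf
    exact syz_backward ι π hπ hex (P.complex.d 2 1).hom (P.complex.d 1 0).hom
      (P.π.f 0).hom hε h21 h10 r g hg f hf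
end
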